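/- Assume (UM): g satisfies (H), L_g = g'(0), and g is bounded. Let w₀ satisfy (IC1), let c > c_# (χ₀(·;c) has two distinct positive real zeros λ₁ < λ₂), fix λ_c ∈ (λ₁, λ₂), and let φ be a semi-wavefront with speed c. Assume g is differentiable on [κ−ρ, κ+ρ] with |g'(u)| < 1 there, for some ρ > 0, and that for some b ≥ 0: (i) κ − ρ/4 ≤ w₀(s,z) ≤ κ + ρ/4 and κ − ρ/4 ≤ φ(z) ≤ κ + ρ/4 for all z ≥ b − ch, s ∈ [−h,0]; (ii) |w₀(s,z) − φ(z)| ≤ 0.5ρ e^{λ_c(z−b)} for all z ≤ b, s ∈ [−h,0]. Then φ is actually a wavefront (φ(+∞) = κ) and there exists γ > 0 such that every classical solution w of (E1) with initial datum w₀ satisfies |w(t,·) − φ(·)|_{λ_c} ≤ 0.5ρ e^{−γt} for all t ≥ 0. -/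

import Mathlib

open Set Filter

noncomputable section

/-- The weight function `η_λ(t) = min{e^{λt}, 1}`. -/
def eta (lam t : ℝ) : ℝ := min (Real.exp (lam * t)) 1

/-- The characteristic function `χ₀(λ) = λ² − cλ − 1 + g0·e^{−λch}` (with `g0 = g'(0)`). -/
def chi (g0 c h lam : ℝ) : ℝ := lam ^ 2 - c * lam - 1 + g0 * Real.exp (-(lam * c * h))

/-- Hypothesis (H) on the birth function `g` (extended linearly and C¹-smoothly to `(−∞,0]`). -/
structure HypH (g : ℝ → ℝ) (kap del0 Lg : ℝ) : Prop where
  cont : Continuous g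
  nonneg : ∀ x : ℝ, 0 ≤ x → 0 ≤ g x
  kap_pos : 0 < kap
  del0_pos : 0 < del0
  fixed_points : ∀ x : ℝ, 0 ≤ x → (g x = x ↔ x = 0 ∨ x = kap)
  smooth0 : ContDiffOn ℝ 1 g (Set.Ioo (-del0) del0)
  smooth_kap : ContDiffOn ℝ 1 g (Set.Ioo (kap - del0) (kap + del0))
  deriv0_gt : 1 < deriv g 0
  deriv_kap_lt : deriv g kap < 1
  lipschitz : ∀ u v : ℝ, 0 ≤ u → 0 ≤ v → |g u - g v| ≤ Lg * |u - v|
  holder : ∃ C > (0:ℝ), ∃ θ ∈ Set.Ioc (0:ℝ) 1,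
      ∀ u ∈ Set.Ioc (0:ℝ) del0, |deriv g u - deriv g 0| ≤ C * u ^ θ
  ext_linear : ∀ x : ℝ, x ≤ 0 → g x = deriv g 0 * x

/-- (IC1): `0 ≤ w₀ ≤ sup w₀ < ∞` on `Π₀ = [−h,0]×ℝ`. -/
def IC1 (h : ℝ) (w0 : ℝ → ℝ → ℝ) : Prop :=
  ∃ M : ℝ, ∀ s ∈ Set.Icc (-h) 0, ∀ x : ℝ, 0 ≤ w0 s x ∧ w0 s x ≤ M

/-- (IC2): `liminf_{x→+∞} min_{s∈[−h,0]} w₀(s,x) > 0`. -/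
def IC2 (h : ℝ) (w0 : ℝ → ℝ → ℝ) : Prop :=
  ∃ m > (0:ℝ), ∃ X : ℝ, ∀ x ≥ X, ∀ s ∈ Set.Icc (-h) 0, m ≤ w0 s x

/-- `w₀` is locally Hölder continuous in `x`, uniformly in `s ∈ [−h,0]`. -/
def LocHolder (h : ℝ) (w0 : ℝ → ℝ → ℝ) : Prop :=
  ∀ R > (0:ℝ), ∃ K > (0:ℝ), ∃ β ∈ Set.Ioc (0:ℝ) 1,
    ∀ s ∈ Set.Icc (-h) 0, ∀ x ∈ Set.Icc (-R) R, ∀ y ∈ Set.Icc (-R) R,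
      |w0 s x - w0 s y| ≤ K * |x - y| ^ β

/-- A classical solution of the equation (*):
`u_t(t,x) = u_{xx}(t,x) − u(t,x) + g(u(t−h,x))` for `t > 0`, `x ∈ ℝ`. -/
def SolvesStar (g : ℝ → ℝ) (h : ℝ) (u : ℝ → ℝ → ℝ) : Prop :=
  ContinuousOn (fun p : ℝ × ℝ => u p.1 p.2) {p : ℝ × ℝ | -h ≤ p.1} ∧
  (∀ T : ℝ, ∃ M : ℝ, ∀ t ∈ Set.Icc (-h) T, ∀ x : ℝ, |u t x| ≤ M) ∧
  (∀ t : ℝ, 0 < t → ∀ x : ℝ,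
      DifferentiableAt ℝ (fun τ => u τ x) t ∧
      DifferentiableAt ℝ (fun y => u t y) x ∧
      DifferentiableAt ℝ (deriv (fun y => u t y)) x ∧
      deriv (fun τ => u τ x) t =
        deriv (deriv (fun y => u t y)) x - u t x + g (u (t - h) x)) ∧
  ContinuousOn (fun p : ℝ × ℝ => deriv (fun τ => u τ p.2) p.1) {p : ℝ × ℝ | 0 < p.1} ∧
  ContinuousOn (fun p : ℝ × ℝ => deriv (fun y => u p.1 y) p.2) {p : ℝ × ℝ | 0 < p.1} ∧
  ContinuousOn (fun p : ℝ × ℝ => deriv (deriv (fun y => u p.1 y)) p.2) {p : ℝ × ℝ | 0 < p.1}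

/-- A classical solution of equation (E1):
`w_t = w_{zz} − c w_z − w + g(w(t−h, z−ch))` for `t > 0`, `z ∈ ℝ`. -/
def SolvesE1 (g : ℝ → ℝ) (h c : ℝ) (w : ℝ → ℝ → ℝ) : Prop :=
  ContinuousOn (fun p : ℝ × ℝ => w p.1 p.2) {p : ℝ × ℝ | -h ≤ p.1} ∧
  (∀ T : ℝ, ∃ M : ℝ, ∀ t ∈ Set.Icc (-h) T, ∀ z : ℝ, |w t z| ≤ M) ∧
  (∀ t : ℝ, 0 < t → ∀ z : ℝ,
      DifferentiableAt ℝ (fun τ => w τ z) t ∧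
      DifferentiableAt ℝ (fun y => w t y) z ∧
      DifferentiableAt ℝ (deriv (fun y => w t y)) z ∧
      deriv (fun τ => w τ z) t =
        deriv (deriv (fun y => w t y)) z - c * deriv (fun y => w t y) z
          - w t z + g (w (t - h) (z - c * h))) ∧
  ContinuousOn (fun p : ℝ × ℝ => deriv (fun τ => w τ p.2) p.1) {p : ℝ × ℝ | 0 < p.1} ∧
  ContinuousOn (fun p : ℝ × ℝ => deriv (fun y => w p.1 y) p.2) {p : ℝ × ℝ | 0 < p.1} ∧
  ContinuousOn (fun p : ℝ × ℝ => deriv (deriv (fun y => w p.1 y)) p.2) {p : ℝ × ℝ | 0 < p.1}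

/-- A wavefront with speed `c`: a positive bounded C² solution of the profile equation
with `φ(−∞) = 0`, `φ(+∞) = κ`. -/
def IsWavefront (g : ℝ → ℝ) (h c kap : ℝ) (φ : ℝ → ℝ) : Prop :=
  (∀ z : ℝ, 0 < φ z) ∧ (∃ M : ℝ, ∀ z : ℝ, φ z ≤ M) ∧ ContDiff ℝ 2 φ ∧
  (∀ z : ℝ, deriv (deriv φ) z - c * deriv φ z - φ z + g (φ (z - c * h)) = 0) ∧
  Filter.Tendsto φ Filter.atBot (nhds 0) ∧ Filter.Tendsto φ Filter.atTop (nhds kap)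

/-- A semi-wavefront with speed `c`: as a wavefront, but at `+∞` only
`liminf_{z→+∞} φ(z) > 0` is required. -/
def IsSemiWavefront (g : ℝ → ℝ) (h c : ℝ) (φ : ℝ → ℝ) : Prop :=
  (∀ z : ℝ, 0 < φ z) ∧ (∃ M : ℝ, ∀ z : ℝ, φ z ≤ M) ∧ ContDiff ℝ 2 φ ∧
  (∀ z : ℝ, deriv (deriv φ) z - c * deriv φ z - φ z + g (φ (z - c * h)) = 0) ∧
  Filter.Tendsto φ Filter.atBot (nhds 0) ∧
  (∃ m > (0:ℝ), ∀ᶠ z in Filter.atTop, m ≤ φ z)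

/-- The nonlinear operator `𝒩` associated with (E1). -/
def Nop (g : ℝ → ℝ) (h c : ℝ) (w : ℝ → ℝ → ℝ) (t z : ℝ) : ℝ :=
  deriv (fun τ => w τ z) t - deriv (deriv (fun y => w t y)) z
    + c * deriv (fun y => w t y) z + w t z - g (w (t - h) (z - c * h))

/-- A super-solution of (E1) with break point `zs`. -/
def IsSuperSolution (g : ℝ → ℝ) (h c : ℝ) (w : ℝ → ℝ → ℝ) (zs : ℝ) : Prop :=
  ContinuousOn (fun p : ℝ × ℝ => w p.1 p.2) {p : ℝ × ℝ | -h ≤ p.1} ∧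
  (∀ t : ℝ, -h < t → ∀ z : ℝ, DifferentiableAt ℝ (fun τ => w τ z) t) ∧
  (∀ t : ℝ, -h ≤ t → ∀ z : ℝ, z ≠ zs →
      DifferentiableAt ℝ (fun y => w t y) z ∧
      DifferentiableAt ℝ (deriv (fun y => w t y)) z) ∧
  (∀ t : ℝ, 0 < t → ∀ z : ℝ, z ≠ zs → 0 ≤ Nop g h c w t z) ∧
  (∀ t : ℝ, 0 < t →
      derivWithin (fun y => w t y) (Set.Iic zs) zs
        > derivWithin (fun y => w t y) (Set.Ici zs) zs)

/-- A sub-solution of (E1) with break point `zs` (all inequalities reversed). -/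
def IsSubSolution (g : ℝ → ℝ) (h c : ℝ) (w : ℝ → ℝ → ℝ) (zs : ℝ) : Prop :=
  ContinuousOn (fun p : ℝ × ℝ => w p.1 p.2) {p : ℝ × ℝ | -h ≤ p.1} ∧
  (∀ t : ℝ, -h < t → ∀ z : ℝ, DifferentiableAt ℝ (fun τ => w τ z) t) ∧
  (∀ t : ℝ, -h ≤ t → ∀ z : ℝ, z ≠ zs →
      DifferentiableAt ℝ (fun y => w t y) z ∧
      DifferentiableAt ℝ (deriv (fun y => w t y)) z) ∧
  (∀ t : ℝ, 0 < t → ∀ z : ℝ, z ≠ zs → Nop g h c w t z ≤ 0) ∧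
  (∀ t : ℝ, 0 < t →
      derivWithin (fun y => w t y) (Set.Iic zs) zs
        < derivWithin (fun y => w t y) (Set.Ici zs) zs)


open Topology

theorem second_derivative_nonpos_of_isLocalMax {f f1 : ℝ → ℝ} {f2 z : ℝ}
    (hmax : IsLocalMax f z) (hf : ∀ᶠ y in 𝓝 z, HasDerivAt f (f1 y) y)
    (hf1 : HasDerivAt f1 f2 z) : f1 z = 0 ∧ f2 ≤ 0 := by
  have hz : f1 z = 0 := hmax.hasDerivAt_eq_zero hf.self_of_nhds
  refine ⟨hz, ?_⟩
  by_contra! hpos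
  have hd : deriv f =ᶠ[𝓝 z] f1 := hf.mono fun y hy => hy.deriv
  have hdd : deriv (deriv f) z = f2 := by rw [hd.deriv_eq, hf1.deriv]
  have hmin : IsLocalMin f z := isLocalMin_of_deriv_deriv_pos (by rw [hdd]; exact hpos)
    (by rw [hd.eq_of_nhds, hz]) hf.self_of_nhds.continuousAt
  have hconst : f =ᶠ[𝓝 z] fun _ => f z := by
    filter_upwards [hmax, hmin] with y h1 h2 using le_antisymm h1 h2
  have h0 : deriv f =ᶠ[𝓝 z] fun _ => 0 := by
    filter_upwards [hconst.eventuallyEq_nhds] with y hy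
    rw [hy.deriv_eq]; simp
  have : deriv (deriv f) z = 0 := by rw [h0.deriv_eq]; simp
  linarith

theorem derivative_nonneg_of_max_at_right {f : ℝ → ℝ} {f' a t : ℝ} (hat : a < t)
    (hf : HasDerivAt f f' t) (hmax : ∀ s ∈ Icc a t, f s ≤ f t) : 0 ≤ f' := by
  have h := (hasDerivWithinAt_iff_tendsto_slope' (s := Iio t) (by simp)).1 hf.hasDerivWithinAt
  refine ge_of_tendsto h ?_
  filter_upwards [Ioo_mem_nhdsLT hat] with s hs
  rw [slope_def_field]
  exact div_nonneg_of_nonpos (by linarith [hmax s ⟨hs.1.le, hs.2.le⟩]) (by linarith [hs.2])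

/-- Comparison principle on a strip for `v_t - v_zz + c v_z + v`: the barrier `V` only has to be
touched from above, in `z`, by a function which is a super-solution at the touching point. -/
theorem parabolic_comparison {c T0 T1 M : ℝ} {v V vt v1 v2 : ℝ → ℝ → ℝ}
    (hcont : ContinuousOn (fun p : ℝ × ℝ => v p.1 p.2 - V p.1 p.2) (Icc T0 T1 ×ˢ univ))
    (hM : ∀ t ∈ Icc T0 T1, ∀ z, v t z - V t z ≤ M)
    (h0 : ∀ z, v T0 z ≤ V T0 z)
    (ht : ∀ t ∈ Ioc T0 T1, ∀ z, HasDerivAt (fun τ => v τ z) (vt t z) t)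
    (h1 : ∀ t ∈ Ioc T0 T1, ∀ z, HasDerivAt (v t) (v1 t z) z)
    (h2 : ∀ t ∈ Ioc T0 T1, ∀ z, HasDerivAt (v1 t) (v2 t z) z)
    (hV : ∀ t ∈ Ioc T0 T1, ∀ z, V t z < v t z → ∃ (Ft : ℝ) (F F1 : ℝ → ℝ) (F2 : ℝ),
      HasDerivAt (fun τ => V τ z) Ft t ∧ (∀ᶠ y in 𝓝 z, V t y ≤ F y) ∧ F z = V t z ∧
      (∀ᶠ y in 𝓝 z, HasDerivAt F (F1 y) y) ∧ HasDerivAt F1 F2 z ∧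
      vt t z - v2 t z + c * v1 t z + v t z ≤ Ft - F2 + c * F1 z + V t z) :
    ∀ t ∈ Icc T0 T1, ∀ z, v t z ≤ V t z := by
  intro t htm z
  by_contra! hlt
  set K : ℝ := c ^ 2 + 3 with hK
  have hKpos : 0 < z ^ 2 + K := by positivity
  set ε : ℝ := (v t z - V t z) / (2 * (z ^ 2 + K)) with hε
  have hεpos : 0 < ε := div_pos (by linarith) (by linarith)
  set U : ℝ × ℝ → ℝ := fun p => v p.1 p.2 - V p.1 p.2 - ε * (p.2 ^ 2 + K) with hU
  have hUtz : 0 < U (t, z) := by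
    have : ε * (z ^ 2 + K) = (v t z - V t z) / 2 := by
      rw [hε]; field_simp
    simp only [hU, this]; linarith
  set R : ℝ := |z| + |M| / ε + 1 with hR
  have hMε : 0 ≤ |M| / ε := by positivity
  have hUc : ContinuousOn U (Icc T0 T1 ×ˢ Icc (-R) R) :=
    (hcont.mono (prod_mono_right (subset_univ _))).sub (by fun_prop)
  have hzR : |z| ≤ R := by linarith
  obtain ⟨⟨t', z'⟩, hmem, hmax⟩ := (isCompact_Icc.prod isCompact_Icc).exists_isMaxOn
    ⟨(t, z), ⟨htm, abs_le.1 hzR⟩⟩ hUc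
  have hU' : 0 < U (t', z') := hUtz.trans_le (hmax (a := (t, z)) ⟨htm, abs_le.1 hzR⟩)
  have hmax' : ∀ s ∈ Icc T0 T1, ∀ y, U (s, y) ≤ U (t', z') := by
    intro s hs y
    by_cases hy : |y| ≤ R
    · exact hmax (a := (s, y)) ⟨hs, abs_le.1 hy⟩
    · push Not at hy
      refine le_trans ?_ hU'.le
      have hy1 : 1 ≤ |y| := by linarith [abs_nonneg z]
      have hy2 : |M| / ε ≤ y ^ 2 := by rw [← sq_abs]; nlinarith [abs_nonneg z]
      have hy3 : |M| ≤ ε * y ^ 2 := by rwa [div_le_iff₀' hεpos] at hy2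
      have : 0 ≤ ε * K := by positivity
      simp only [hU]
      linarith [hM s hs y, le_abs_self M]
  have ht' : t' ∈ Ioc T0 T1 := by
    refine ⟨lt_of_le_of_ne hmem.1.1 ?_, hmem.1.2⟩
    rintro rfl
    have : 0 ≤ ε * (z' ^ 2 + K) := by positivity
    simp only [hU] at hU'
    linarith [h0 z']
  have hεz : 0 < ε * (z' ^ 2 + K) := by positivity
  have hlt' : V t' z' + ε * (z' ^ 2 + K) < v t' z' := by
    simp only [hU] at hU'; linarith
  obtain ⟨Ft, F, F1, F2, hFt, hVF, hFz, hF1, hF2, hineq⟩ := hV t' ht' z' (by linarith)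
  have htime : 0 ≤ vt t' z' - Ft := by
    refine derivative_nonneg_of_max_at_right ht'.1 ((ht t' ht' z').sub hFt) fun s hs => ?_
    have := hmax' s ⟨hs.1, hs.2.trans ht'.2⟩ z'
    simp only [hU] at this
    simp only [Pi.sub_apply]
    linarith
  have hspace := second_derivative_nonpos_of_isLocalMax
    (f := fun y => v t' y - F y - ε * (y ^ 2 + K))
    (f1 := fun y => v1 t' y - F1 y - ε * (2 * y)) (f2 := v2 t' z' - F2 - ε * 2) (z := z')
    (by
      filter_upwards [hVF] with y hy
      have := hmax' t' hmem.1 y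
      simp only [hU] at this
      simp only [hFz]
      linarith)
    (by
      filter_upwards [hF1] with y hy
      have hp : HasDerivAt (fun x : ℝ => ε * (x ^ 2 + K)) (ε * (2 * y)) y := by
        simpa using (((hasDerivAt_id y).pow 2).add_const K).const_mul ε
      exact ((h1 t' ht' y).sub hy).sub hp)
    (by
      have hp : HasDerivAt (fun x : ℝ => ε * (2 * x)) (ε * 2) z' := by
        simpa using ((hasDerivAt_id z').const_mul 2).const_mul ε
      exact ((h2 t' ht' z').sub hF2).sub hp)
  obtain ⟨hs1, hs2⟩ := hspace
  have hs1' : v1 t' z' = F1 z' + ε * (2 * z') := by linarith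
  rw [hs1'] at hineq
  have : 0 < ε * ((z' + c) ^ 2 + 1) := by positivity
  have hid : ε * ((z' + c) ^ 2 + 1) = ε * (z' ^ 2 + K) - 2 * ε + c * (ε * (2 * z')) := by
    rw [hK]; ring
  nlinarith

/-- A bounded solution of `y'' - c y' - y + f = 0` is asymptotically bounded by the forcing. -/
theorem eventually_le_of_forcing_le {c B q q' Z : ℝ} {y y1 y2 f : ℝ → ℝ} (hc : 0 < c)
    (hq : 0 ≤ q) (hqq' : q < q') (hB : ∀ z, y z ≤ B)
    (h1 : ∀ z, HasDerivAt y (y1 z) z) (h2 : ∀ z, HasDerivAt y1 (y2 z) z)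
    (heq : ∀ z, y2 z - c * y1 z - y z + f z = 0) (hf : ∀ z, Z ≤ z → f z ≤ q) :
    ∀ᶠ z in atTop, y z ≤ q' := by
  wlog hB0 : 0 ≤ B generalizing B
  · exact this (B := 0) (fun z => (hB z).trans (not_le.1 hB0).le) le_rfl
  set μ : ℝ := 1 / (1 + c) with hμ
  have hμpos : 0 < μ := by positivity
  have hμ1 : μ * (1 + c) = 1 := by rw [hμ]; field_simp
  have hμ2 : μ ^ 2 + c * μ ≤ 1 := by nlinarith
  have hyc : Continuous y := continuous_iff_continuousAt.2 fun z => (h1 z).continuousAt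
  set V : ℝ → ℝ → ℝ := fun t z => q + B * Real.exp (-(μ * (z - Z))) + B * Real.exp (-t) with hVdef
  have key : ∀ t, 0 ≤ t → ∀ z, y z ≤ V t z := by
    intro T hT
    refine parabolic_comparison (c := c) (T0 := 0) (T1 := T) (M := B) (v := fun _ z => y z)
      (V := V) (vt := fun _ _ => 0) (v1 := fun _ => y1) (v2 := fun _ => y2) ?_ ?_ ?_ ?_ ?_ ?_ ?_
      T ⟨hT, le_rfl⟩
    · exact Continuous.continuousOn (by simp only [hVdef]; fun_prop)
    · intro t _ z
      have : 0 ≤ V t z := by simp only [hVdef]; positivity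
      linarith [hB z]
    · intro z
      have : 0 ≤ B * Real.exp (-(μ * (z - Z))) := by positivity
      simp only [hVdef, neg_zero, Real.exp_zero]
      linarith [hB z]
    · exact fun t _ z => hasDerivAt_const _ _
    · exact fun t _ z => h1 z
    · exact fun t _ z => h2 z
    · intro t _ z hlt
      have hE : ∀ x, HasDerivAt (fun x => Real.exp (-(μ * (x - Z))))
          (-μ * Real.exp (-(μ * (x - Z)))) x := by
        intro x
        have := ((((hasDerivAt_id x).sub_const Z).const_mul μ).neg).exp
        simpa [mul_comm] using this
      have hzZ : Z ≤ z := by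
        by_contra! hzZ
        have : 1 ≤ Real.exp (-(μ * (z - Z))) := Real.one_le_exp (by nlinarith)
        have h3 : 0 ≤ B * Real.exp (-t) := by positivity
        simp only [hVdef] at hlt
        nlinarith [hB z]
      refine ⟨-(B * Real.exp (-t)), V t, fun x => B * (-μ * Real.exp (-(μ * (x - Z)))),
        B * (-μ * (-μ * Real.exp (-(μ * (z - Z))))), ?_, Eventually.of_forall fun _ => le_rfl,
        rfl, Eventually.of_forall fun x => ?_, ?_, ?_⟩
      · have := (((hasDerivAt_id t).neg.exp).const_mul B).const_add
          (q + B * Real.exp (-(μ * (z - Z))))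
        simpa [hVdef] using this
      · exact (((hE x).const_mul B).const_add q).add_const _
      · exact ((hE z).const_mul (-μ)).const_mul B
      · have h3 : 0 ≤ B * Real.exp (-(μ * (z - Z))) := by positivity
        simp only [hVdef]
        nlinarith [heq z, hf z hzZ]
  have hlim : Tendsto (fun z => V z z) atTop (𝓝 q) := by
    have e1 : Tendsto (fun z : ℝ => Real.exp (-(μ * (z - Z)))) atTop (𝓝 0) :=
      Real.tendsto_exp_neg_atTop_nhds_zero.comp
        ((tendsto_atTop_add_const_right atTop (-Z) tendsto_id).const_mul_atTop hμpos)
    have e2 := Real.tendsto_exp_neg_atTop_nhds_zero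
    simpa using ((e1.const_mul B).const_add q).add (e2.const_mul B)
  filter_upwards [hlim.eventually_lt_const hqq', eventually_ge_atTop 0] with z hz hz0
  exact (key z hz0 z).trans hz.le

/-- The weight equal to `e^{λ(z-b)}` left of `b` and to `1 + θ(1 - e^{-λ(z-b)})` right of `b`. -/
def barrier (lam b θ z : ℝ) : ℝ :=
  if z ≤ b then Real.exp (lam * (z - b)) else 1 + θ * (1 - Real.exp (-(lam * (z - b))))

section barrier

variable {lam b θ z : ℝ}

theorem barrier_of_le (hz : z ≤ b) : barrier lam b θ z = Real.exp (lam * (z - b)) := if_pos hz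

theorem barrier_of_gt (hz : b < z) :
    barrier lam b θ z = 1 + θ * (1 - Real.exp (-(lam * (z - b)))) := if_neg hz.not_ge

theorem continuous_barrier : Continuous (barrier lam b θ) := by
  unfold barrier
  refine Continuous.if_le (by fun_prop) (by fun_prop) continuous_id continuous_const ?_
  rintro x rfl
  simp

theorem barrier_nonneg (hlam : 0 ≤ lam) (hθ : 0 ≤ θ) : 0 ≤ barrier lam b θ z := by
  rcases le_or_gt z b with hz | hz
  · rw [barrier_of_le hz]; positivity
  · rw [barrier_of_gt hz]
    have : Real.exp (-(lam * (z - b))) ≤ 1 :=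
      Real.exp_le_one_iff.2 (by nlinarith)
    nlinarith

theorem barrier_le_exp (hθ : θ ≤ 1) (hlam : 0 ≤ lam) :
    barrier lam b θ z ≤ Real.exp (lam * (z - b)) := by
  rcases le_or_gt z b with hz | hz
  · rw [barrier_of_le hz]
  · rw [barrier_of_gt hz]
    have h1 : Real.exp (-(lam * (z - b))) ≤ 1 := Real.exp_le_one_iff.2 (by nlinarith)
    have h2 : Real.exp (-(lam * (z - b))) * Real.exp (lam * (z - b)) = 1 := by
      rw [← Real.exp_add]; simp
    have h3 : 0 ≤ Real.exp (-(lam * (z - b))) * (Real.exp (lam * (z - b)) - 1) ^ 2 := by positivity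
    have h4 : Real.exp (-(lam * (z - b))) * (Real.exp (lam * (z - b)) - 1) ^ 2 =
        Real.exp (lam * (z - b)) - 2 + Real.exp (-(lam * (z - b))) := by
      linear_combination (Real.exp (lam * (z - b)) - 2) * h2
    nlinarith

theorem barrier_le_mul (hθ : 0 ≤ θ) :
    barrier lam b θ z ≤ (1 + θ) * barrier lam b 0 z := by
  rcases le_or_gt z b with hz | hz
  · rw [barrier_of_le hz, barrier_of_le hz]
    nlinarith [Real.exp_pos (lam * (z - b))]
  · rw [barrier_of_gt hz, barrier_of_gt hz]
    nlinarith [Real.exp_pos (-(lam * (z - b)))]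

theorem barrier_zero_le (hlam : 0 ≤ lam) (hθ : 0 ≤ θ) :
    barrier lam b 0 z ≤ barrier lam b θ z := by
  rcases le_or_gt z b with hz | hz
  · rw [barrier_of_le hz, barrier_of_le hz]
  · rw [barrier_of_gt hz, barrier_of_gt hz]
    have h1 : Real.exp (-(lam * (z - b))) ≤ 1 := Real.exp_le_one_iff.2 (by nlinarith)
    nlinarith

theorem barrier_zero_le_one (hlam : 0 ≤ lam) : barrier lam b 0 z ≤ 1 := by
  rcases le_or_gt z b with hz | hz
  · rw [barrier_of_le hz]
    exact Real.exp_le_one_iff.2 (by nlinarith)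
  · rw [barrier_of_gt hz]; simp

theorem barrier_mono (hlam : 0 ≤ lam) (hθ : 0 ≤ θ) : Monotone (barrier lam b θ) := by
  intro x y hxy
  rcases le_or_gt y b with hy | hy
  · rw [barrier_of_le hy, barrier_of_le (hxy.trans hy)]
    gcongr
  · rcases le_or_gt x b with hx | hx
    · calc barrier lam b θ x = barrier lam b 0 x := by rw [barrier_of_le hx, barrier_of_le hx]
        _ ≤ 1 := barrier_zero_le_one hlam
        _ = barrier lam b 0 y := by rw [barrier_of_gt hy]; simp
        _ ≤ _ := barrier_zero_le hlam hθ
    · rw [barrier_of_gt hy, barrier_of_gt hx]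
      gcongr

theorem barrier_zero_le_eta (hlam : 0 ≤ lam) (hb : 0 ≤ b) : barrier lam b 0 z ≤ eta lam z := by
  refine le_min ((barrier_le_exp zero_le_one hlam).trans ?_) (barrier_zero_le_one hlam)
  gcongr
  linarith

theorem hasDerivAt_exp_mul_sub (k b x : ℝ) :
    HasDerivAt (fun y => Real.exp (k * (y - b))) (k * Real.exp (k * (x - b))) x := by
  have := (((hasDerivAt_id x).sub_const b).const_mul k).exp
  simpa [mul_comm] using this

/-- If `|G|` is dominated by the action of the operator on `A e^{-γ(t-T0)} barrier`, with `G` only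
involving the past, then this function remains a barrier for `|v|`. -/
theorem abs_le_barrier_of_delay {c h T0 T1 A γ : ℝ} {v vt v1 v2 : ℝ → ℝ → ℝ}
    (hh : 0 < h) (hA : 0 ≤ A) (hlam : 0 < lam) (hθ0 : 0 ≤ θ) (hθ1 : θ ≤ 1)
    (hcont : ContinuousOn (fun p : ℝ × ℝ => v p.1 p.2) (Icc T0 T1 ×ˢ univ))
    (hM : ∃ M, ∀ t ∈ Icc T0 T1, ∀ z, |v t z| ≤ M)
    (ht : ∀ t ∈ Ioc T0 T1, ∀ z, HasDerivAt (fun τ => v τ z) (vt t z) t)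
    (h1 : ∀ t ∈ Ioc T0 T1, ∀ z, HasDerivAt (v t) (v1 t z) z)
    (h2 : ∀ t ∈ Ioc T0 T1, ∀ z, HasDerivAt (v1 t) (v2 t z) z)
    (hinit : ∀ t ∈ Icc (T0 - h) T0, ∀ z,
      |v t z| ≤ A * Real.exp (-(γ * (t - T0))) * barrier lam b θ z)
    (hstep : ∀ t ∈ Ioc T0 T1,
      (∀ z, |v (t - h) z| ≤ A * Real.exp (-(γ * (t - h - T0))) * barrier lam b θ z) →
      (∀ z, z ≤ b → |vt t z - v2 t z + c * v1 t z + v t z| ≤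
        A * Real.exp (-(γ * (t - T0))) *
          ((1 - γ + c * lam - lam ^ 2) * Real.exp (lam * (z - b)))) ∧
      (∀ z, b < z → |vt t z - v2 t z + c * v1 t z + v t z| ≤
        A * Real.exp (-(γ * (t - T0))) * ((1 - γ) * barrier lam b θ z +
          θ * (lam ^ 2 + c * lam) * Real.exp (-(lam * (z - b)))))) :
    ∀ t ∈ Icc (T0 - h) T1, ∀ z,
      |v t z| ≤ A * Real.exp (-(γ * (t - T0))) * barrier lam b θ z := by
  set V : ℝ → ℝ → ℝ := fun t z => A * Real.exp (-(γ * (t - T0))) * barrier lam b θ z with hVdef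
  have hV0 : ∀ t z, 0 ≤ V t z := fun t z =>
    mul_nonneg (by positivity) (barrier_nonneg hlam.le hθ0)
  have hVc : Continuous (fun p : ℝ × ℝ => V p.1 p.2) := by
    have : Continuous (fun p : ℝ × ℝ => barrier lam b θ p.2) :=
      continuous_barrier.comp continuous_snd
    simp only [hVdef]
    fun_prop
  obtain ⟨M, hM⟩ := hM
  have touch : ∀ t ∈ Ioc T0 T1, (∀ z, |v (t - h) z| ≤ V (t - h) z) → ∀ z,
      ∃ (Ft : ℝ) (F F1 : ℝ → ℝ) (F2 : ℝ),
      HasDerivAt (fun τ => V τ z) Ft t ∧ (∀ᶠ y in 𝓝 z, V t y ≤ F y) ∧ F z = V t z ∧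
      (∀ᶠ y in 𝓝 z, HasDerivAt F (F1 y) y) ∧ HasDerivAt F1 F2 z ∧
      |vt t z - v2 t z + c * v1 t z + v t z| ≤ Ft - F2 + c * F1 z + V t z := by
    intro t htm hpast z
    obtain ⟨hl, hr⟩ := hstep t htm hpast
    set E : ℝ := A * Real.exp (-(γ * (t - T0))) with hE
    have hE0 : 0 ≤ E := by positivity
    have hFt : HasDerivAt (fun τ => V τ z) (-γ * E * barrier lam b θ z) t := by
      have := ((hasDerivAt_exp_mul_sub (-γ) T0 t).const_mul A).mul_const (barrier lam b θ z)
      simp only [neg_mul] at this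
      exact this.congr_deriv (by simp only [hE]; ring)
    rcases le_or_gt z b with hz | hz
    · refine ⟨_, fun y => E * Real.exp (lam * (y - b)),
        fun y => E * (lam * Real.exp (lam * (y - b))),
        E * (lam * (lam * Real.exp (lam * (z - b)))), hFt, Eventually.of_forall fun y => ?_, ?_,
        Eventually.of_forall fun y => ?_, ?_, ?_⟩
      · exact mul_le_mul_of_nonneg_left (barrier_le_exp hθ1 hlam.le) hE0
      · simp only [hVdef, barrier_of_le hz, ← hE]
      · exact (hasDerivAt_exp_mul_sub lam b y).const_mul E
      · exact ((hasDerivAt_exp_mul_sub lam b z).const_mul lam).const_mul E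
      · refine (hl z hz).trans (le_of_eq ?_)
        simp only [hVdef, barrier_of_le hz, ← hE]
        ring
    · have hder : ∀ y, HasDerivAt (fun x => Real.exp (-(lam * (x - b))))
          (-lam * Real.exp (-(lam * (y - b)))) y := by
        intro y
        have := hasDerivAt_exp_mul_sub (-lam) b y
        simpa only [neg_mul] using this
      refine ⟨_, fun y => E * (1 + θ * (1 - Real.exp (-(lam * (y - b))))),
        fun y => E * (θ * -(-lam * Real.exp (-(lam * (y - b))))),
        E * (θ * -(-lam * (-lam * Real.exp (-(lam * (z - b)))))), hFt, ?_, ?_,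
        Eventually.of_forall fun y => ?_, ?_, ?_⟩
      · filter_upwards [lt_mem_nhds hz] with y hy
        simp only [hVdef, barrier_of_gt hy, ← hE, le_refl]
      · simp only [hVdef, barrier_of_gt hz, ← hE]
      · exact ((((hder y).const_sub 1).const_mul θ).const_add 1).const_mul E
      · exact ((((hder z).const_mul (-lam)).neg).const_mul θ).const_mul E
      · refine (hr z hz).trans (le_of_eq ?_)
        simp only [hVdef, ← hE]
        ring
  have key : ∀ n : ℕ, ∀ t ∈ Icc (T0 - h) (min T1 (T0 + n * h)), ∀ z, |v t z| ≤ V t z := by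
    intro n
    induction n with
    | zero =>
      intro t htm z
      have := htm.2.trans (min_le_right _ _)
      exact hinit t ⟨htm.1, by simpa using this⟩ z
    | succ n ih =>
      intro t htm z
      rcases le_or_gt t T0 with h0 | h0
      · exact hinit t ⟨htm.1, h0⟩ z
      · set T2 := min T1 (T0 + (n + 1 : ℕ) * h) with hT2
        have hT21 : T2 ≤ T1 := min_le_left _ _
        have hT2n : T2 ≤ T0 + (n + 1) * h := by
          have : T2 ≤ T0 + (n + 1 : ℕ) * h := min_le_right _ _
          push_cast at this
          exact this
        have hpast : ∀ s ∈ Ioc T0 T2, ∀ z, |v (s - h) z| ≤ V (s - h) z := by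
          intro s hs
          refine ih (s - h) ⟨by linarith [hs.1], le_min (by linarith [hs.2]) ?_⟩
          nlinarith [hs.2]
        have hsub : ∀ s ∈ Ioc T0 T2, s ∈ Ioc T0 T1 := fun s hs => ⟨hs.1, hs.2.trans hT21⟩
        have hsub' : Icc T0 T2 ×ˢ (univ : Set ℝ) ⊆ Icc T0 T1 ×ˢ univ :=
          prod_mono_left (Icc_subset_Icc_right hT21)
        have h0' : ∀ z, |v T0 z| ≤ V T0 z := hinit T0 ⟨by linarith, le_rfl⟩
        have hb : ∀ s ∈ Icc T0 T2, ∀ z, |v s z| ≤ M := fun s hs => hM s ⟨hs.1, hs.2.trans hT21⟩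
        rw [abs_le']
        constructor
        · refine parabolic_comparison (c := c) (M := M) ((hcont.mono hsub').sub hVc.continuousOn)
            (fun s hs y => ?_) (fun y => (le_abs_self _).trans (h0' y))
            (fun s hs => ht s (hsub s hs)) (fun s hs => h1 s (hsub s hs))
            (fun s hs => h2 s (hsub s hs)) (fun s hs y _ => ?_) t ⟨h0.le, htm.2⟩ z
          · linarith [hV0 s y, hb s hs y, le_abs_self (v s y)]
          · obtain ⟨Ft, F, F1, F2, a1, a2, a3, a4, a5, a6⟩ := touch s (hsub s hs) (hpast s hs) y
            exact ⟨Ft, F, F1, F2, a1, a2, a3, a4, a5, (le_abs_self _).trans a6⟩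
        · refine parabolic_comparison (c := c) (M := M) (v := fun t z => -v t z)
            (vt := fun t z => -vt t z) (v1 := fun t z => -v1 t z) (v2 := fun t z => -v2 t z)
            (((hcont.mono hsub').neg).sub hVc.continuousOn)
            (fun s hs y => ?_) (fun y => (neg_le_abs _).trans (h0' y))
            (fun s hs y => (ht s (hsub s hs) y).neg) (fun s hs y => (h1 s (hsub s hs) y).neg)
            (fun s hs y => (h2 s (hsub s hs) y).neg) (fun s hs y _ => ?_) t ⟨h0.le, htm.2⟩ z
          · linarith [hV0 s y, hb s hs y, neg_le_abs (v s y)]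
          · obtain ⟨Ft, F, F1, F2, a1, a2, a3, a4, a5, a6⟩ := touch s (hsub s hs) (hpast s hs) y
            refine ⟨Ft, F, F1, F2, a1, a2, a3, a4, a5, le_trans (le_of_eq ?_)
              ((neg_le_abs _).trans a6)⟩
            ring
  intro t htm z
  obtain ⟨n, hn⟩ := exists_nat_ge ((T1 - T0) / h)
  rw [div_le_iff₀ hh] at hn
  exact key n t ⟨htm.1, le_min htm.2 (by linarith [htm.2])⟩ z

end barrier

theorem chi_neg_of_mem_Ioo {g0 c h lam1 lam2 lam : ℝ} (hg0 : 0 < g0)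
    (h1 : chi g0 c h lam1 = 0) (h2 : chi g0 c h lam2 = 0) (hlam : lam ∈ Ioo lam1 lam2) :
    chi g0 c h lam < 0 := by
  obtain ⟨ha, hb⟩ := hlam
  have hd : 0 < lam2 - lam1 := by linarith
  set s := (lam2 - lam) / (lam2 - lam1) with hs
  set t := (lam - lam1) / (lam2 - lam1) with ht
  have hs0 : 0 < s := div_pos (by linarith) hd
  have ht0 : 0 < t := div_pos (by linarith) hd
  have hst : s + t = 1 := by rw [hs, ht]; field_simp; ring
  have hl : lam = s * lam1 + t * lam2 := by rw [hs, ht]; field_simp; ring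
  have hexp := convexOn_exp.2 (mem_univ (-(lam1 * c * h))) (mem_univ (-(lam2 * c * h)))
    hs0.le ht0.le hst
  simp only [smul_eq_mul] at hexp
  have harg : s * -(lam1 * c * h) + t * -(lam2 * c * h) = -(lam * c * h) := by rw [hl]; ring
  rw [harg] at hexp
  have hsq : lam ^ 2 = s * lam1 ^ 2 + t * lam2 ^ 2 - s * t * (lam1 - lam2) ^ 2 := by
    have hs' : s = 1 - t := by linarith
    rw [hl, hs']; ring
  have hpos : 0 < s * t * (lam1 - lam2) ^ 2 := by
    have : 0 < (lam1 - lam2) ^ 2 := by rw [← neg_sq]; simpa using pow_pos hd 2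
    positivity
  unfold chi at h1 h2 ⊢
  have hexp' := mul_le_mul_of_nonneg_left hexp hg0.le
  have e1 : s * (lam1 ^ 2 - c * lam1 - 1 + g0 * Real.exp (-(lam1 * c * h))) = 0 := by
    rw [h1, mul_zero]
  have e2 : t * (lam2 ^ 2 - c * lam2 - 1 + g0 * Real.exp (-(lam2 * c * h))) = 0 := by
    rw [h2, mul_zero]
  have e3 : c * lam = s * (c * lam1) + t * (c * lam2) := by rw [hl]; ring
  rw [hsq, e3]
  nlinarith

theorem HypH.abs_sub_le {g : ℝ → ℝ} {kap del0 Lg : ℝ} (hH : HypH g kap del0 Lg)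
    (hLg : Lg = deriv g 0) (u v : ℝ) : |g u - g v| ≤ Lg * |u - v| := by
  have hL : 0 < Lg := by rw [hLg]; linarith [hH.deriv0_gt]
  have h0 : g 0 = 0 := by simpa using hH.ext_linear 0 le_rfl
  have mixed : ∀ u v : ℝ, u ≤ 0 → 0 ≤ v → |g u - g v| ≤ Lg * |u - v| := by
    intro u v hu hv
    have hv' := hH.lipschitz v 0 hv le_rfl
    rw [h0, sub_zero, sub_zero, abs_of_nonneg hv] at hv'
    rw [hH.ext_linear u hu, ← hLg]
    calc |Lg * u - g v| ≤ |Lg * u| + |g v| := abs_sub _ _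
      _ ≤ Lg * -u + Lg * v := by
          rw [abs_mul, abs_of_pos hL, abs_of_nonpos hu]; linarith
      _ = Lg * |u - v| := by rw [abs_of_nonpos (by linarith)]; ring
  rcases le_total 0 u with hu | hu <;> rcases le_total 0 v with hv | hv
  · exact hH.lipschitz u v hu hv
  · rw [abs_sub_comm, abs_sub_comm u]; exact mixed v u hv hu
  · exact mixed u v hu hv
  · rw [hH.ext_linear u hu, hH.ext_linear v hv, ← hLg, ← mul_sub, abs_mul, abs_of_pos hL]

section Contraction

variable {g : ℝ → ℝ} {x y : ℝ}

theorem abs_sub_lt_of_abs_deriv_lt_one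
    (hg : ∀ v ∈ Icc x y, DifferentiableAt ℝ g v ∧ |deriv g v| < 1)
    {u v : ℝ} (hu : u ∈ Icc x y) (hv : v ∈ Icc x y) (huv : u ≠ v) :
    |g u - g v| < |u - v| := by
  wlog hlt : u < v generalizing u v
  · rw [abs_sub_comm, abs_sub_comm u]
    exact this hv hu huv.symm (lt_of_le_of_ne (not_lt.1 hlt) huv.symm)
  have hsub : ∀ p ∈ Icc u v, p ∈ Icc x y := fun p hp => ⟨hu.1.trans hp.1, hp.2.trans hv.2⟩
  obtain ⟨p, hp, hpe⟩ := exists_deriv_eq_slope g hlt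
    (fun p hp => (hg p (hsub p hp)).1.continuousAt.continuousWithinAt)
    (fun p hp => (hg p (hsub p (Ioo_subset_Icc_self hp))).1.differentiableWithinAt)
  have h1 := (hg p (hsub p (Ioo_subset_Icc_self hp))).2
  rw [hpe, abs_div, div_lt_one (abs_pos.2 (sub_ne_zero.2 huv.symm))] at h1
  rwa [abs_sub_comm, abs_sub_comm u]

theorem abs_sub_le_of_abs_deriv_lt_one
    (hg : ∀ v ∈ Icc x y, DifferentiableAt ℝ g v ∧ |deriv g v| < 1)
    {u v : ℝ} (hu : u ∈ Icc x y) (hv : v ∈ Icc x y) : |g u - g v| ≤ |u - v| := by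
  rcases eq_or_ne u v with rfl | huv
  · simp
  · exact (abs_sub_lt_of_abs_deriv_lt_one hg hu hv huv).le

/-- Away from the diagonal the strict contraction property is uniform. -/
theorem exists_contraction_factor
    (hg : ∀ v ∈ Icc x y, DifferentiableAt ℝ g v ∧ |deriv g v| < 1) {D : ℝ} (hD : 0 < D) :
    ∃ ε > 0, ε ≤ 1 / 2 ∧ ∀ D', D ≤ D' → ∀ u ∈ Icc x y, ∀ v ∈ Icc x y, |u - v| ≤ D' →
      |g u - g v| ≤ (1 - ε) * D' := by
  set K : Set (ℝ × ℝ) := (Icc x y ×ˢ Icc x y) ∩ {p | D / 2 ≤ |p.1 - p.2|} with hK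
  have hKc : IsCompact K := (isCompact_Icc.prod isCompact_Icc).inter_right
    (isClosed_le continuous_const (by fun_prop))
  have hgc : ContinuousOn g (Icc x y) := fun v hv =>
    (hg v hv).1.continuousAt.continuousWithinAt
  have hfc : ContinuousOn (fun p : ℝ × ℝ => |g p.1 - g p.2| / |p.1 - p.2|) K := by
    refine ContinuousOn.div ?_ (by fun_prop) fun p hp => ?_
    · exact ((hgc.comp continuousOn_fst fun p hp => hp.1.1).sub
        (hgc.comp continuousOn_snd fun p hp => hp.1.2)).abs
    · have : D / 2 ≤ |p.1 - p.2| := hp.2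
      linarith
  obtain ⟨m, hm1, hm⟩ : ∃ m < 1, ∀ p ∈ K, |g p.1 - g p.2| / |p.1 - p.2| ≤ m := by
    rcases K.eq_empty_or_nonempty with hemp | hne
    · exact ⟨0, one_pos, by simp [hemp]⟩
    · obtain ⟨p, hp, hmax⟩ := hKc.exists_isMaxOn hne hfc
      refine ⟨_, ?_, hmax⟩
      have hpos : 0 < |p.1 - p.2| := lt_of_lt_of_le (by linarith) hp.2
      rw [div_lt_one hpos]
      exact abs_sub_lt_of_abs_deriv_lt_one hg hp.1.1 hp.1.2 (sub_ne_zero.1 (abs_pos.1 hpos))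
  refine ⟨min (1 - m) (1 / 2), lt_min (by linarith) (by norm_num), min_le_right _ _, ?_⟩
  intro D' hDD' u hu v hv huv
  have hε1 := min_le_left (1 - m) (1 / 2)
  have hε2 := min_le_right (1 - m) (1 / 2)
  rcases le_or_gt (D / 2) |u - v| with hle | hgt
  · have h1 := hm (u, v) ⟨⟨hu, hv⟩, hle⟩
    have hpos : 0 < |u - v| := by linarith
    rw [div_le_iff₀ hpos] at h1
    calc |g u - g v| ≤ m * |u - v| := h1
      _ ≤ (1 - min (1 - m) (1 / 2)) * |u - v| := by gcongr; linarith
      _ ≤ (1 - min (1 - m) (1 / 2)) * D' := by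
          apply mul_le_mul_of_nonneg_left huv; linarith
  · have h1 := abs_sub_le_of_abs_deriv_lt_one hg hu hv
    nlinarith

end Contraction

theorem exists_local_lipschitz_lt_one {g : ℝ → ℝ} {x ρ δ : ℝ} (hρ : 0 < ρ) (hδ : 0 < δ)
    (hsm : ContDiffOn ℝ 1 g (Ioo (x - δ) (x + δ))) (hx : |deriv g x| < 1) :
    ∃ q ∈ Ico (0 : ℝ) 1, ∃ r > 0, r ≤ ρ ∧ ∀ u ∈ Icc (x - r) (x + r), ∀ v ∈ Icc (x - r) (x + r),
      |g u - g v| ≤ q * |u - v| := by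
  have hmem : Ioo (x - δ) (x + δ) ∈ 𝓝 x := Ioo_mem_nhds (by linarith) (by linarith)
  have hcd : ContinuousAt (deriv g) x :=
    (hsm.continuousOn_deriv_of_isOpen isOpen_Ioo le_rfl).continuousAt hmem
  obtain ⟨q, hq1, hq2⟩ := exists_between hx
  have hev : ∀ᶠ y in 𝓝 x, |deriv g y| < q ∧ DifferentiableAt ℝ g y := by
    refine (hcd.abs.eventually_lt_const hq1).and ?_
    filter_upwards [isOpen_Ioo.mem_nhds (mem_of_mem_nhds hmem)] with y hy
    exact (hsm.differentiableOn one_ne_zero).differentiableAt (isOpen_Ioo.mem_nhds hy)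
  obtain ⟨r, hr, hball⟩ := Metric.eventually_nhds_iff.1 hev
  refine ⟨q, ⟨(abs_nonneg _).trans hq1.le, hq2⟩, min (r / 2) ρ, lt_min (by linarith) hρ,
    min_le_right _ _, fun u hu v hv => ?_⟩
  have hin : ∀ y ∈ Icc (x - min (r / 2) ρ) (x + min (r / 2) ρ), dist y x < r := by
    intro y hy
    have := min_le_left (r / 2) ρ
    rw [Real.dist_eq, abs_lt]
    constructor <;> linarith [hy.1, hy.2]
  have := (convex_Icc (x - min (r / 2) ρ) (x + min (r / 2) ρ)).norm_image_sub_le_of_norm_deriv_le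
    (f := g) (C := q) (fun y hy => (hball (hin y hy)).2) (fun y hy => (hball (hin y hy)).1.le) hv hu
  simpa using this

/-- A bounded profile which is eventually trapped where `g` contracts converges to `κ`. -/
theorem tendsto_of_profile_trapped {g φ : ℝ → ℝ} {kap c h ρ Z0 : ℝ} (hc : 0 < c)
    (hρ : 0 < ρ)
    (hg : ∀ v ∈ Icc (kap - ρ) (kap + ρ), DifferentiableAt ℝ g v ∧ |deriv g v| < 1)
    (hkap : g kap = kap) (hbdd : ∃ M, ∀ z, |φ z| ≤ M) (hφ2 : ContDiff ℝ 2 φ)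
    (heq : ∀ z, deriv (deriv φ) z - c * deriv φ z - φ z + g (φ (z - c * h)) = 0)
    (htrap : ∀ z, Z0 ≤ z → |φ z - kap| ≤ ρ) : Tendsto φ atTop (𝓝 kap) := by
  have hd1 : ∀ z, HasDerivAt φ (deriv φ z) z := fun z =>
    (hφ2.differentiable two_ne_zero z).hasDerivAt
  have hd2 : ∀ z, HasDerivAt (deriv φ) (deriv (deriv φ) z) z := fun z =>
    ((hφ2.deriv' (n := 1)).differentiable one_ne_zero z).hasDerivAt
  obtain ⟨M, hM⟩ := hbdd
  set S : Set ℝ := {r | 0 ≤ r ∧ ∀ᶠ z in atTop, |φ z - kap| ≤ r} with hS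
  have hSne : S.Nonempty := ⟨ρ, hρ.le, (eventually_ge_atTop Z0).mono htrap⟩
  have hSbd : BddBelow S := ⟨0, fun r hr => hr.1⟩
  have ha0 : 0 ≤ sInf S := le_csInf hSne fun r hr => hr.1
  have hmem : ∀ r, sInf S < r → ∀ᶠ z in atTop, |φ z - kap| ≤ r := by
    intro r hr
    obtain ⟨r', hr', hlt⟩ := exists_lt_of_csInf_lt hSne hr
    exact hr'.2.mono fun z hz => hz.trans hlt.le
  have ha : sInf S = 0 := by
    by_contra hne
    have hapos : 0 < sInf S := lt_of_le_of_ne ha0 (Ne.symm hne)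
    set a := sInf S with hadef
    obtain ⟨ε, hε, hε2, hcontr⟩ := exists_contraction_factor hg hapos
    set r := a * (1 + ε) with hr
    have har : a < r := by nlinarith
    have hqa : (1 - ε) * r < a := by rw [hr]; nlinarith [mul_pos hapos hε, mul_pos hε hε]
    have hq0 : 0 ≤ (1 - ε) * r := mul_nonneg (by linarith) (by linarith)
    obtain ⟨Z1, hZ1⟩ := eventually_atTop.1 (hmem r har)
    have hforce : ∀ z, max Z0 Z1 + c * h ≤ z → |g (φ (z - c * h)) - kap| ≤ (1 - ε) * r := by
      intro z hz
      have hz0 : Z0 ≤ z - c * h := by linarith [le_max_left Z0 Z1]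
      have hz1 : Z1 ≤ z - c * h := by linarith [le_max_right Z0 Z1]
      have hin := abs_le.1 (htrap _ hz0)
      have := hcontr r har.le _ ⟨by linarith [hin.1], by linarith [hin.2]⟩ kap
        ⟨by linarith, by linarith⟩ (hZ1 _ hz1)
      rwa [hkap] at this
    obtain ⟨q', hq1, hq2⟩ := exists_between hqa
    have up := eventually_le_of_forcing_le (y := fun z => φ z - kap) (y1 := deriv φ)
      (y2 := deriv (deriv φ)) (f := fun z => g (φ (z - c * h)) - kap) (B := M + |kap|) hc hq0 hq1
      (fun z => by linarith [le_abs_self (φ z), hM z, neg_abs_le kap])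
      (fun z => (hd1 z).sub_const kap) hd2 (fun z => by linarith [heq z])
      (fun z hz => (le_abs_self _).trans (hforce z hz))
    have down := eventually_le_of_forcing_le (y := fun z => -(φ z - kap))
      (y1 := fun z => -deriv φ z) (y2 := fun z => -deriv (deriv φ) z)
      (f := fun z => -(g (φ (z - c * h)) - kap)) (B := M + |kap|) hc hq0 hq1
      (fun z => by linarith [neg_abs_le (φ z), hM z, le_abs_self kap])
      (fun z => ((hd1 z).sub_const kap).neg) (fun z => (hd2 z).neg)
      (fun z => by linarith [heq z])
      (fun z hz => (neg_le_abs _).trans (hforce z hz))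
    have : q' ∈ S := ⟨by linarith, by
      filter_upwards [up, down] with z h1 h2 using abs_le'.2 ⟨h1, h2⟩⟩
    linarith [csInf_le hSbd this]
  rw [Metric.tendsto_atTop']
  intro e he
  obtain ⟨N, hN⟩ := eventually_atTop.1 (hmem (e / 2) (by rw [ha]; linarith))
  exact ⟨N, fun z hz => by rw [Real.dist_eq]; linarith [hN z hz.le]⟩

/-- Barrier estimate for the difference between a solution of (E1) and a stationary profile. -/
theorem SolvesE1.abs_sub_le_barrier {g φ : ℝ → ℝ} {w : ℝ → ℝ → ℝ}
    {c h L T0 T1 A γ lam b θ : ℝ} (hw : SolvesE1 g h c w)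
    (hh : 0 < h) (hT0 : 0 ≤ T0) (hA : 0 ≤ A) (hlam : 0 < lam) (hθ0 : 0 ≤ θ) (hθ1 : θ ≤ 1)
    (hc : 0 < c) (hL : 0 ≤ L) (hlip : ∀ u v, |g u - g v| ≤ L * |u - v|)
    (hφbdd : ∃ M, ∀ z, |φ z| ≤ M) (hφ2 : ContDiff ℝ 2 φ)
    (heq : ∀ z, deriv (deriv φ) z - c * deriv φ z - φ z + g (φ (z - c * h)) = 0)
    (hγ : L * Real.exp (γ * h) * Real.exp (-(lam * c * h)) ≤ 1 - γ + c * lam - lam ^ 2)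
    (hinit : ∀ t ∈ Icc (T0 - h) T0, ∀ z,
      |w t z - φ z| ≤ A * Real.exp (-(γ * (t - T0))) * barrier lam b θ z)
    (hstep : ∀ t ∈ Ioc T0 T1,
      (∀ z, |w (t - h) z - φ z| ≤ A * Real.exp (-(γ * (t - h - T0))) * barrier lam b θ z) →
      ∀ z, b < z → |g (w (t - h) (z - c * h)) - g (φ (z - c * h))| ≤
        A * Real.exp (-(γ * (t - T0))) * ((1 - γ) * barrier lam b θ z +
          θ * (lam ^ 2 + c * lam) * Real.exp (-(lam * (z - b))))) :
    ∀ t ∈ Icc (T0 - h) T1, ∀ z,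
      |w t z - φ z| ≤ A * Real.exp (-(γ * (t - T0))) * barrier lam b θ z := by
  obtain ⟨hwc, hwb, hwd, -⟩ := hw
  obtain ⟨M, hM⟩ := hφbdd
  have hd1 : ∀ z, HasDerivAt φ (deriv φ z) z := fun z =>
    (hφ2.differentiable two_ne_zero z).hasDerivAt
  have hd2 : ∀ z, HasDerivAt (deriv φ) (deriv (deriv φ) z) z := fun z =>
    ((hφ2.deriv' (n := 1)).differentiable one_ne_zero z).hasDerivAt
  have hpos : ∀ t ∈ Ioc T0 T1, 0 < t := fun t ht => hT0.trans_lt ht.1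
  have hres : ∀ t ∈ Ioc T0 T1, ∀ z,
      deriv (fun τ => w τ z) t - (deriv (deriv (fun y => w t y)) z - deriv (deriv φ) z)
        + c * (deriv (fun y => w t y) z - deriv φ z) + (w t z - φ z)
      = g (w (t - h) (z - c * h)) - g (φ (z - c * h)) := by
    intro t ht z
    linarith [(hwd t (hpos t ht) z).2.2.2, heq z]
  refine abs_le_barrier_of_delay (c := c) (v := fun t z => w t z - φ z)
    (vt := fun t z => deriv (fun τ => w τ z) t)
    (v1 := fun t z => deriv (fun y => w t y) z - deriv φ z)
    (v2 := fun t z => deriv (deriv (fun y => w t y)) z - deriv (deriv φ) z)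
    hh hA hlam hθ0 hθ1 ?_ ?_ ?_ ?_ ?_ hinit ?_
  · refine (hwc.mono ?_).sub (hφ2.continuous.comp continuous_snd).continuousOn
    rintro ⟨t, z⟩ ⟨ht, -⟩
    have : T0 ≤ t := ht.1
    show -h ≤ t
    linarith
  · obtain ⟨M', hM'⟩ := hwb T1
    refine ⟨M' + M, fun t ht z => (abs_sub _ _).trans (add_le_add (hM' t ⟨?_, ht.2⟩ z) (hM z))⟩
    linarith [ht.1]
  · exact fun t ht z => (hwd t (hpos t ht) z).1.hasDerivAt.sub_const (φ z)
  · exact fun t ht z => (hwd t (hpos t ht) z).2.1.hasDerivAt.sub (hd1 z)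
  · exact fun t ht z => (hwd t (hpos t ht) z).2.2.1.hasDerivAt.sub (hd2 z)
  · intro t ht hpast
    refine ⟨fun z hz => ?_, fun z hz => ?_⟩
    · rw [hres t ht z]
      have hz' : z - c * h ≤ b := by nlinarith [mul_pos hc hh]
      have h1 := hpast (z - c * h)
      rw [barrier_of_le hz'] at h1
      have e1 : Real.exp (-(γ * (t - h - T0))) =
          Real.exp (-(γ * (t - T0))) * Real.exp (γ * h) := by
        rw [← Real.exp_add]; ring_nf
      have e2 : Real.exp (lam * (z - c * h - b)) =
          Real.exp (lam * (z - b)) * Real.exp (-(lam * c * h)) := by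
        rw [← Real.exp_add]; ring_nf
      calc _ ≤ L * |w (t - h) (z - c * h) - φ (z - c * h)| := hlip _ _
        _ ≤ L * (A * Real.exp (-(γ * (t - h - T0))) * Real.exp (lam * (z - c * h - b))) := by
            gcongr
        _ = A * Real.exp (-(γ * (t - T0))) * ((L * Real.exp (γ * h) * Real.exp (-(lam * c * h)))
              * Real.exp (lam * (z - b))) := by rw [e1, e2]; ring
        _ ≤ _ := by gcongr
    · rw [hres t ht z]
      exact hstep t ht hpast z hz

theorem eventually_neg_nhdsGT_zero {f : ℝ → ℝ} (hf : Continuous f) (h0 : f 0 < 0) :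
    ∀ᶠ x in 𝓝[>] 0, f x < 0 :=
  nhdsWithin_le_nhds (hf.continuousAt.eventually_lt_const h0)


set_option maxHeartbeats 1000000 in
/-- **Lemma `L7` (stability near κ in the moving frame).**
Under (UM), `c > c_#`, `λ_c ∈ (λ₁,λ₂)`, `|g'| < 1` on `[κ−ρ,κ+ρ]`, if the initial
datum is within `ρ/4` of `κ` (together with `φ`) for `z ≥ b − ch` and within
`0.5ρ e^{λ_c(z−b)}` of `φ` for `z ≤ b`, then `φ(+∞) = κ` and
`|w(t,·) − φ(·)|_{λ_c} ≤ 0.5ρ e^{−γt}` for all `t ≥ 0` and some `γ > 0`. -/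
theorem stability_near_kappa_moving_frame
    (g : ℝ → ℝ) (kap del0 Lg h c : ℝ)
    -- (UM): (H), L_g = g'(0), g bounded
    (hH : HypH g kap del0 Lg) (hLg : Lg = deriv g 0)
    (hbdd : ∃ M : ℝ, ∀ x : ℝ, 0 ≤ x → g x ≤ M)
    (hh : 0 < h) (hc : 0 < c)
    (w0 : ℝ → ℝ → ℝ) (hIC1 : IC1 h w0)
    -- c > c_# : χ₀(·;c) has two distinct positive real zeros λ₁ < λ₂
    (lam1 lam2 : ℝ) (hlam1_pos : 0 < lam1) (hlam_lt : lam1 < lam2)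
    (hchi1 : chi (deriv g 0) c h lam1 = 0) (hchi2 : chi (deriv g 0) c h lam2 = 0)
    (lamc : ℝ) (hlamc : lamc ∈ Set.Ioo lam1 lam2)
    (φ : ℝ → ℝ) (hφ : IsSemiWavefront g h c φ)
    -- |g'(u)| < 1 on [κ−ρ, κ+ρ]
    (ρ : ℝ) (hρ : 0 < ρ)
    (hg' : ∀ v ∈ Set.Icc (kap - ρ) (kap + ρ),
        DifferentiableAt ℝ g v ∧ |deriv g v| < 1)
    (b : ℝ) (hb : 0 ≤ b)
    -- (i): w₀ and φ stay within ρ/4 of κ for z ≥ b − ch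
    (hnear : ∀ z : ℝ, b - c * h ≤ z → ∀ s ∈ Set.Icc (-h) 0,
        kap - ρ / 4 ≤ w0 s z ∧ w0 s z ≤ kap + ρ / 4 ∧
        kap - ρ / 4 ≤ φ z ∧ φ z ≤ kap + ρ / 4)
    -- (ii): |w₀(s,z) − φ(z)| ≤ 0.5ρ e^{λ_c(z−b)} for z ≤ b
    (hclose : ∀ z : ℝ, z ≤ b → ∀ s ∈ Set.Icc (-h) 0,
        |w0 s z - φ z| ≤ 0.5 * ρ * Real.exp (lamc * (z - b)))
    -- w : a classical solution of (E1) with initial datum w₀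
    (w : ℝ → ℝ → ℝ) (hw : SolvesE1 g h c w)
    (hinit : ∀ s ∈ Set.Icc (-h) 0, ∀ z : ℝ, w s z = w0 s z) :
    Filter.Tendsto φ Filter.atTop (nhds kap) ∧
    ∃ γ > (0:ℝ), ∀ t ≥ (0:ℝ), ∀ z : ℝ,
      |w t z - φ z| ≤ 0.5 * ρ * Real.exp (-(γ * t)) * eta lamc z := by
  subst hLg
  have hmem0 : (0 : ℝ) ∈ Icc (-h) 0 := ⟨by linarith, le_rfl⟩
  have hkap : g kap = kap := (hH.fixed_points kap hH.kap_pos.le).2 (Or.inr rfl)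
  have hL : 0 < deriv g 0 := by linarith [hH.deriv0_gt]
  have hlam : 0 < lamc := hlam1_pos.trans hlamc.1
  have hch : 0 < c * h := mul_pos hc hh
  have hchi := chi_neg_of_mem_Ioo hL hchi1 hchi2 hlamc
  unfold chi at hchi
  obtain ⟨hφpos, ⟨Mφ, hMφ⟩, hφ2, heq, -, -⟩ := hφ
  have hφbdd : ∃ M, ∀ z, |φ z| ≤ M := ⟨Mφ, fun z => by rw [abs_of_pos (hφpos z)]; exact hMφ z⟩
  have hφnear : ∀ z, b - c * h ≤ z → |φ z - kap| ≤ ρ / 4 := fun z hz => by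
    obtain ⟨-, -, h1, h2⟩ := hnear z hz 0 hmem0
    exact abs_le.2 ⟨by linarith, by linarith⟩
  have hφlim : Tendsto φ atTop (𝓝 kap) :=
    tendsto_of_profile_trapped hc hρ hg' hkap hφbdd hφ2 heq
      fun z hz => (hφnear z hz).trans (by linarith)
  refine ⟨hφlim, ?_⟩
  obtain ⟨q, ⟨hq0, hq1⟩, r, hr, hrρ, hlocal⟩ := exists_local_lipschitz_lt_one
    (show 0 < ρ / 4 by linarith) hH.del0_pos hH.smooth_kap
    (hg' kap ⟨by linarith, by linarith⟩).2
  obtain ⟨Z, hZ⟩ : ∃ Z, ∀ z, Z ≤ z → |φ z - kap| ≤ r / 2 := by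
    obtain ⟨Z, hZ⟩ := eventually_atTop.1
      (Metric.tendsto_nhds.1 hφlim (r / 2) (by linarith))
    exact ⟨Z, fun z hz => by rw [← Real.dist_eq]; exact (hZ z hz).le⟩
  set D : ℝ := r / 16 with hD
  have hDpos : 0 < D := by positivity
  obtain ⟨ε, hε, hε2, hcontr⟩ := exists_contraction_factor hg' hDpos
  have hrate : ∀ᶠ γ in 𝓝[>] (0 : ℝ), deriv g 0 * Real.exp (γ * h) * Real.exp (-(lamc * c * h))
      - (1 - γ + c * lamc - lamc ^ 2) < 0 :=
    eventually_neg_nhdsGT_zero (by fun_prop) (by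
      simp only [zero_mul, Real.exp_zero, mul_one, sub_zero]; linarith)
  have hrate2 : ∀ᶠ γ in 𝓝[>] (0 : ℝ), Real.exp (γ * h) - 2 < 0 :=
    eventually_neg_nhdsGT_zero (by fun_prop) (by
      simp only [zero_mul, Real.exp_zero]; norm_num)
  have hrateq : ∀ p < 1, ∀ᶠ γ in 𝓝[>] (0 : ℝ), p * Real.exp (γ * h) - (1 - γ) < 0 :=
    fun p hp => eventually_neg_nhdsGT_zero (by fun_prop) (by
      simp only [zero_mul, Real.exp_zero]; linarith)
  have hpos : ∀ᶠ γ in 𝓝[>] (0 : ℝ), 0 < γ := self_mem_nhdsWithin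
  -- the rate while the difference stays large
  obtain ⟨γ1, ⟨⟨⟨hγ1, hγ1rate⟩, hγ1two⟩, hγ1ε⟩⟩ :=
    (((hpos.and hrate).and hrate2).and (hrateq (1 - ε) (by linarith))).exists
  have hratio : 1 ≤ ρ / (2 * D) := by
    rw [le_div_iff₀ (by positivity)]; linarith
  set T : ℝ := Real.log (ρ / (2 * D)) / γ1 with hT
  have hT0 : 0 ≤ T := div_nonneg (Real.log_nonneg hratio) hγ1.le
  have hexpT : ρ / 2 * Real.exp (-(γ1 * T)) = D := by
    rw [hT, mul_div_cancel₀ _ hγ1.ne', Real.exp_neg, Real.exp_log (by linarith)]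
    field_simp
  have hw0near : ∀ s ∈ Icc (-h) 0, ∀ z, b - c * h ≤ z → |w s z - φ z| ≤ ρ / 2 := by
    intro s hs z hz
    rw [hinit s hs z]
    obtain ⟨h1, h2, h3, h4⟩ := hnear z hz s hs
    exact abs_le.2 ⟨by linarith, by linarith⟩
  have stage1 : ∀ t ∈ Icc (-h) T, ∀ z,
      |w t z - φ z| ≤ ρ / 2 * Real.exp (-(γ1 * t)) * barrier lamc b 0 z := by
    have := hw.abs_sub_le_barrier (φ := φ) (T0 := 0) (T1 := T) (A := ρ / 2) (γ := γ1) (lam := lamc)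
      (b := b) (θ := 0) hh le_rfl (by positivity) hlam le_rfl zero_le_one hc hL.le
      (hH.abs_sub_le rfl) hφbdd hφ2 heq (by linarith) ?_ ?_
    · simpa only [zero_sub, sub_zero] using this
    · intro s hs z
      rw [zero_sub] at hs
      have h1 : 1 ≤ Real.exp (-(γ1 * (s - 0))) := Real.one_le_exp (by nlinarith [hs.2])
      have h2 : |w s z - φ z| ≤ ρ / 2 * barrier lamc b 0 z := by
        rcases le_or_gt z b with hz | hz
        · rw [barrier_of_le hz, hinit s hs z]
          exact (hclose z hz s hs).trans (le_of_eq (by ring))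
        · rw [barrier_of_gt hz, zero_mul, add_zero, mul_one]
          exact hw0near s hs z (by linarith)
      have h3 : 0 ≤ barrier lamc b 0 z := barrier_nonneg hlam.le le_rfl
      exact h2.trans (by gcongr; nlinarith)
    · intro t ht hpast z hz
      simp only [sub_zero] at hpast ⊢
      have hz' : b - c * h ≤ z - c * h := by linarith
      have hE : Real.exp (-(γ1 * (t - h))) = Real.exp (-(γ1 * t)) * Real.exp (γ1 * h) := by
        rw [← Real.exp_add]; ring_nf
      set d : ℝ := ρ / 2 * Real.exp (-(γ1 * (t - h))) with hd
      have hb1 : barrier lamc b 0 (z - c * h) ≤ 1 := barrier_zero_le_one hlam.le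
      have hle : |w (t - h) (z - c * h) - φ (z - c * h)| ≤ d :=
        (hpast _).trans (mul_le_of_le_one_right (by positivity) hb1)
      have hle' : |w (t - h) (z - c * h) - φ (z - c * h)| ≤ ρ / 2 := by
        rcases le_or_gt (t - h) 0 with hth | hth
        · exact hw0near _ ⟨by linarith [ht.1], hth⟩ _ hz'
        · refine hle.trans (mul_le_of_le_one_right (by positivity) ?_)
          exact Real.exp_le_one_iff.2 (by nlinarith)
      have hDd : D ≤ d := by
        rw [← hexpT, hd]
        gcongr
        linarith [ht.2]
      have h1 := abs_le.1 (hφnear _ hz')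
      have h2 := abs_le.1 hle'
      refine (hcontr d hDd _ ⟨by linarith, by linarith⟩ _ ⟨by linarith, by linarith⟩ hle).trans ?_
      rw [barrier_of_gt hz]
      simp only [zero_mul, add_zero, mul_one]
      calc (1 - ε) * d = ρ / 2 * Real.exp (-(γ1 * t)) * ((1 - ε) * Real.exp (γ1 * h)) := by
            rw [hd, hE]; ring
        _ ≤ _ := by gcongr; linarith
  -- the rate once the difference is small
  have hrate3 : ∀ᶠ γ in 𝓝[>] (0 : ℝ), (Real.exp (γ * h) - 1 + γ) * 2
      - (lamc ^ 2 + c * lamc) * Real.exp (-(lamc * (Z + c * h - b))) < 0 :=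
    eventually_neg_nhdsGT_zero (by fun_prop) (by
      have : 0 < (lamc ^ 2 + c * lamc) * Real.exp (-(lamc * (Z + c * h - b))) := by positivity
      simp only [zero_mul, Real.exp_zero]; linarith)
  obtain ⟨γ2, ⟨⟨⟨⟨hγ2, hγ2rate⟩, hγ2two⟩, hγ2q⟩, hγ2Z⟩⟩ :=
    ((((hpos.and hrate).and hrate2).and (hrateq q hq1)).and hrate3).exists
  have hb2 : ∀ z, barrier lamc b 1 z ≤ 2 * barrier lamc b 0 z := fun z => by
    have := barrier_le_mul (lam := lamc) (b := b) (z := z) zero_le_one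
    linarith
  have stage2 : ∀ T1, ∀ t ∈ Icc (T - h) T1, ∀ z,
      |w t z - φ z| ≤ 2 * D * Real.exp (-(γ2 * (t - T))) * barrier lamc b 1 z := by
    intro T1
    refine hw.abs_sub_le_barrier (L := deriv g 0) hh hT0 (by positivity) hlam zero_le_one le_rfl hc
      hL.le (hH.abs_sub_le rfl) hφbdd hφ2 heq (by linarith) ?_ ?_
    · intro t ht z
      have h1 : 1 ≤ Real.exp (-(γ2 * (t - T))) := Real.one_le_exp (by nlinarith [ht.2])
      have h2 : ρ / 2 * Real.exp (-(γ1 * t)) ≤ 2 * D := by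
        calc ρ / 2 * Real.exp (-(γ1 * t)) ≤ ρ / 2 * Real.exp (-(γ1 * T) + γ1 * h) := by
              gcongr; nlinarith [ht.1]
          _ = D * Real.exp (γ1 * h) := by rw [Real.exp_add, ← mul_assoc, hexpT]
          _ ≤ D * 2 := by gcongr; linarith
          _ = 2 * D := mul_comm _ _
      have h3 : 0 ≤ barrier lamc b 0 z := barrier_nonneg hlam.le le_rfl
      refine (stage1 t ⟨by linarith [ht.1], ht.2⟩ z).trans ?_
      have h4 : ρ / 2 * Real.exp (-(γ1 * t)) ≤ 2 * D * Real.exp (-(γ2 * (t - T))) :=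
        h2.trans (le_mul_of_one_le_right (by positivity) h1)
      exact mul_le_mul h4 (barrier_zero_le hlam.le zero_le_one) h3 (by positivity)
    · intro t ht hpast z hz
      have hz' : b - c * h ≤ z - c * h := by linarith
      set E : ℝ := 2 * D * Real.exp (-(γ2 * (t - T))) with hE
      have hE0 : 0 ≤ E := by positivity
      have hED : E ≤ 2 * D := mul_le_of_le_one_right (by positivity)
        (Real.exp_le_one_iff.2 (by nlinarith [ht.1]))
      have hEe : 2 * D * Real.exp (-(γ2 * (t - h - T))) = E * Real.exp (γ2 * h) := by
        rw [hE, mul_assoc (2 * D), ← Real.exp_add]; ring_nf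
      have hbz : 0 ≤ barrier lamc b 1 z := barrier_nonneg hlam.le zero_le_one
      have hbz2 : barrier lamc b 1 z ≤ 2 := by
        linarith [hb2 z, barrier_zero_le_one (b := b) (z := z) hlam.le]
      have hle : |w (t - h) (z - c * h) - φ (z - c * h)| ≤
          E * (Real.exp (γ2 * h) * barrier lamc b 1 z) := by
        refine (hpast _).trans ?_
        rw [hEe, mul_assoc]
        gcongr
        exact barrier_mono hlam.le zero_le_one (by linarith)
      have hle' : |w (t - h) (z - c * h) - φ (z - c * h)| ≤ r / 2 := by
        calc _ ≤ E * (Real.exp (γ2 * h) * barrier lamc b 1 z) := hle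
          _ ≤ 2 * D * (2 * 2) := by gcongr; linarith
          _ = r / 2 := by rw [hD]; ring
      have h2 := abs_le.1 hle'
      rcases le_or_gt z (Z + c * h) with hzZ | hzZ
      · have h1 := abs_le.1 (hφnear _ hz')
        refine (abs_sub_le_of_abs_deriv_lt_one hg' ⟨by linarith, by linarith⟩
          ⟨by linarith, by linarith⟩).trans (hle.trans ?_)
        have h3 : Real.exp (-(lamc * (Z + c * h - b))) ≤ Real.exp (-(lamc * (z - b))) := by
          gcongr
        have h4 : (lamc ^ 2 + c * lamc) * Real.exp (-(lamc * (Z + c * h - b))) ≤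
            (lamc ^ 2 + c * lamc) * Real.exp (-(lamc * (z - b))) := by gcongr
        have h5 : 1 ≤ Real.exp (γ2 * h) := Real.one_le_exp (by positivity)
        gcongr
        nlinarith
      · have h1 := abs_le.1 (hZ (z - c * h) (by linarith))
        refine (hlocal _ ⟨by linarith, by linarith⟩ _ ⟨by linarith, by linarith⟩).trans ?_
        calc q * |w (t - h) (z - c * h) - φ (z - c * h)|
            ≤ q * (E * (Real.exp (γ2 * h) * barrier lamc b 1 z)) := by gcongr
          _ = E * ((q * Real.exp (γ2 * h)) * barrier lamc b 1 z) := by ring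
          _ ≤ E * ((1 - γ2) * barrier lamc b 1 z) := by gcongr; linarith
          _ ≤ _ := by
            gcongr
            have : 0 ≤ 1 * (lamc ^ 2 + c * lamc) * Real.exp (-(lamc * (z - b))) := by positivity
            linarith
  have hrate4 : ∀ᶠ γ in 𝓝[>] (0 : ℝ), Real.exp (γ * T) - 2 < 0 :=
    eventually_neg_nhdsGT_zero (by fun_prop) (by
      simp only [zero_mul, Real.exp_zero]; norm_num)
  obtain ⟨γ3, hγ3, hγ3T⟩ := (hpos.and hrate4).exists
  refine ⟨min γ1 (min γ2 γ3), lt_min hγ1 (lt_min hγ2 hγ3), fun t ht z => ?_⟩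
  set γ := min γ1 (min γ2 γ3)
  have hγγ1 : γ ≤ γ1 := min_le_left _ _
  have hγγ2 : γ ≤ γ2 := (min_le_right _ _).trans (min_le_left _ _)
  have hγγ3 : γ ≤ γ3 := (min_le_right _ _).trans (min_le_right _ _)
  have heta : barrier lamc b 0 z ≤ eta lamc z := barrier_zero_le_eta hlam.le hb
  have hb0 : 0 ≤ barrier lamc b 0 z := barrier_nonneg hlam.le le_rfl
  suffices |w t z - φ z| ≤ ρ / 2 * Real.exp (-(γ * t)) * barrier lamc b 0 z by
    calc _ ≤ ρ / 2 * Real.exp (-(γ * t)) * barrier lamc b 0 z := this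
      _ ≤ ρ / 2 * Real.exp (-(γ * t)) * eta lamc z := by gcongr
      _ = _ := by ring
  rcases le_or_gt t T with htT | htT
  · refine (stage1 t ⟨by linarith, htT⟩ z).trans ?_
    gcongr
  · refine (stage2 t t ⟨by linarith, le_rfl⟩ z).trans ?_
    have h1 : Real.exp (-(γ2 * (t - T))) ≤ Real.exp (-(γ * t)) * 2 := by
      calc Real.exp (-(γ2 * (t - T))) ≤ Real.exp (-(γ * t) + γ3 * T) := by
            gcongr; nlinarith
        _ = Real.exp (-(γ * t)) * Real.exp (γ3 * T) := Real.exp_add _ _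
        _ ≤ _ := by gcongr; linarith
    calc 2 * D * Real.exp (-(γ2 * (t - T))) * barrier lamc b 1 z
        ≤ 2 * D * (Real.exp (-(γ * t)) * 2) * (2 * barrier lamc b 0 z) := by
          gcongr
          · exact barrier_nonneg hlam.le zero_le_one
          · exact hb2 z
      _ = 8 * D * (Real.exp (-(γ * t)) * barrier lamc b 0 z) := by ring
      _ ≤ ρ / 2 * (Real.exp (-(γ * t)) * barrier lamc b 0 z) := by
          gcongr
          linarith
      _ = _ := by ring

end
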